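/- Let ρ be the canonical sequential form of a non-crossing partition of length a ≥ 1, let b ≥ 1, and assume ρ starts with a single 1 if b ≥ 2. For the subword τ = (ρ+1)1^b (each letter of ρ increased by 1, followed by b ones) and any n ≥ a+b−1, the total number of occurrences of τ over all non-crossing partitions of [n] equals binom(2r−2, r+1), where r = n − a − b + 2. -/

import Mathlib

/-- `l` is a restricted growth sequence (canonical sequential form of a set
partition): it starts with 1, all letters are ≥ 1, and each letter is at most
one more than the maximum of the preceding prefix. -/
def IsRGS (l : List ℕ) : Prop :=
  l.getD 0 1 = 1 ∧ (∀ x ∈ l, 1 ≤ x) ∧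
  ∀ i, i + 1 < l.length → l.getD (i + 1) 0 ≤ (l.take (i + 1)).foldr max 0 + 1

/-- `l` contains a (classical) occurrence of 1-2-1-2: a subsequence a,b,a,b with a < b. -/
def Crossing (l : List ℕ) : Prop :=
  ∃ i j k m : ℕ, i < j ∧ j < k ∧ k < m ∧ m < l.length ∧
    l.getD i 0 = l.getD k 0 ∧ l.getD j 0 = l.getD m 0 ∧ l.getD i 0 < l.getD j 0

/-- `l` is the canonical sequential form of a non-crossing partition of [n]. -/
def NCseq (n : ℕ) (l : List ℕ) : Prop := l.length = n ∧ IsRGS l ∧ ¬ Crossing l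

/-- Two lists of the same length are order-isomorphic. -/
def OrdIso (s t : List ℕ) : Prop :=
  s.length = t.length ∧ ∀ j k, j < s.length → k < s.length →
    (s.getD j 0 < s.getD k 0 ↔ t.getD j 0 < t.getD k 0)

/-- The subword pattern `τ` occurs in `l` starting at position `i`. -/
def occAt (τ l : List ℕ) (i : ℕ) : Prop := OrdIso τ ((l.drop i).take τ.length)

/-- The number of occurrences of the subword pattern `τ` in `l`. -/
noncomputable def occCount (τ l : List ℕ) : ℕ := Nat.card {i : ℕ // occAt τ l i}

/-- The total number of occurrences of the subword pattern `τ` over all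
members of NC_n, counted with multiplicity (as marked occurrences). -/
noncomputable def totalOcc (n : ℕ) (τ : List ℕ) : ℕ :=
  Nat.card {p : List ℕ × ℕ // NCseq n p.1 ∧ occAt τ p.1 p.2}

open Finset

/-- The number of ways to extend a state with `k` open blocks by `m` letters. -/
def extCount : ℕ → ℕ → ℕ
  | 0, _ => 1
  | m + 1, k => ∑ j ∈ range (k + 1), extCount m (j + 1)

/-- The number of ways to drop strictly below level `i + 1` and continue with `m` letters. -/
def dropCount (m i : ℕ) : ℕ := ∑ j ∈ range i, extCount m (j + 1)

theorem dropCount_zero (i : ℕ) : dropCount 0 i = i := by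
  simp [dropCount, extCount]

theorem dropCount_succ_succ (m i : ℕ) :
    dropCount (m + 1) (i + 1) = dropCount (m + 1) i + dropCount m (i + 2) := by
  simp only [dropCount, sum_range_succ _ i]
  rfl

theorem dropCount_add_choose (m i : ℕ) :
    dropCount m i + (2 * m + i + 1).choose (m + i + 1) = (2 * m + i + 1).choose (m + 1) := by
  induction m generalizing i with
  | zero => simp [dropCount_zero]
  | succ m ihm =>
    induction i with
    | zero => simp [dropCount]
    | succ i ihi =>
      have h := ihm (i + 2)
      rw [dropCount_succ_succ]
      have e1 := Nat.choose_succ_succ' (2 * m + i + 3) (m + i + 2)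
      have e2 := Nat.choose_succ_succ' (2 * m + i + 3) (m + 1)
      ring_nf at *
      omega

/-- The total number of drops in extensions by `m + 1` letters of a state with `i + 1` open
blocks, where a drop from the initial state also counts. -/
def descentCount : ℕ → ℕ → ℕ
  | 0, i => dropCount 0 i
  | m + 1, i => ∑ t ∈ range (i + 2), descentCount m t + dropCount (m + 1) i

theorem descentCount_eq (m i : ℕ) :
    descentCount m i =
      i * (2 * m + i + 1).choose m + (2 * m + i + 2).choose (m + i + 3) := by
  induction m generalizing i with
  | zero => simp [descentCount, dropCount_zero]
  | succ m ihm =>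
    induction i with
    | zero =>
      simp only [descentCount, sum_range_succ, range_zero, sum_empty, ihm, dropCount]
      have e1 := Nat.choose_succ_succ' (2 * m + 3) (m + 3)
      have e2 := Nat.choose_succ_succ' (2 * m + 2) (m + 2)
      have e3 : (2 * m + 2).choose m = (2 * m + 2).choose (m + 2) :=
        Nat.choose_symm_of_eq_add (by ring)
      ring_nf at *
      omega
    | succ i ihi =>
      have h1 := dropCount_succ_succ m i
      have h2 := dropCount_add_choose m (i + 2)
      simp only [descentCount] at ihi ⊢
      rw [sum_range_succ, ihm (i + 2), h1]
      have e0 : (2 * m + i + 3).choose (m + i + 3) = (2 * m + i + 3).choose m :=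
        Nat.choose_symm_of_eq_add (by ring)
      have e1 := Nat.choose_succ_succ' (2 * m + i + 3) m
      have e2 := Nat.choose_succ_succ' (2 * m + i + 4) (m + i + 4)
      have e3 : 2 * (m + 1) + (i + 1) + 1 = 2 * m + i + 3 + 1 := by ring
      have e4 : 2 * (m + 1) + (i + 1) + 2 = 2 * m + i + 4 + 1 := by ring
      have e5 : 2 * (m + 1) + i + 1 = 2 * m + i + 3 := by ring
      have e6 : 2 * (m + 1) + i + 2 = 2 * m + i + 4 := by ring
      have e7 : 2 * m + (i + 2) + 1 = 2 * m + i + 3 := by ring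
      have e8 : 2 * m + (i + 2) + 2 = 2 * m + i + 4 := by ring
      have e9 : m + (i + 2) + 1 = m + i + 3 := by ring
      have e10 : m + 1 + (i + 1) + 3 = m + i + 4 + 1 := by ring
      have e11 : m + 1 + i + 3 = m + i + 4 := by ring
      have e12 : m + (i + 2) + 3 = m + i + 5 := by ring
      rw [e5, e6, e11] at ihi
      rw [e7, e9] at h2
      rw [e3, e4, e7, e8, e10, e12, e1, e2]
      linarith [ihi, h2, e0]

theorem sum_rank (f : ℕ → ℕ) (S : Finset ℕ) :
    ∑ x ∈ S, f (#{y ∈ S | y ≤ x}) = ∑ j ∈ range #S, f (j + 1) := by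
  induction S using Finset.induction_on_max with
  | empty => simp
  | insert a s ha ih =>
    have hn : a ∉ s := fun h => (ha a h).false
    have h1 : {y ∈ insert a s | y ≤ a} = insert a s :=
      filter_true_of_mem fun y hy => by
        rcases mem_insert.1 hy with rfl | h
        exacts [le_rfl, (ha y h).le]
    have h2 : ∀ x ∈ s, {y ∈ insert a s | y ≤ x} = {y ∈ s | y ≤ x} := fun x hx => by
      rw [filter_insert, if_neg (ha x hx).not_ge]
    rw [sum_insert hn, h1, card_insert_of_notMem hn, sum_range_succ, ← ih, add_comm,
      sum_congr rfl fun x hx => by rw [h2 x hx]]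

/-- The state reached after reading a prefix: the set of letters which may still be repeated
without creating a crossing, and the largest letter read. -/
abbrev BlockState := Finset ℕ × ℕ

namespace BlockState

/-- The letters which may be read next. -/
def avail (σ : BlockState) : Finset ℕ := insert (σ.2 + 1) σ.1

/-- The state after reading the letter `x`. -/
def step (σ : BlockState) (x : ℕ) : BlockState := ({y ∈ σ.avail | y ≤ x}, max σ.2 x)

/-- The state after reading the word `l`. -/
def run (σ : BlockState) (l : List ℕ) : BlockState := l.foldl step σ

/-- Every letter of `l` may be read in turn, starting from `σ`. -/
def Valid : BlockState → List ℕ → Prop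
  | _, [] => True
  | σ, x :: l => x ∈ σ.avail ∧ Valid (σ.step x) l

/-- The repeatable letters are bounded by the largest letter read. -/
def Bounded (σ : BlockState) : Prop := ∀ x ∈ σ.1, x ≤ σ.2

theorem mem_avail {σ : BlockState} {x : ℕ} : x ∈ σ.avail ↔ x = σ.2 + 1 ∨ x ∈ σ.1 := by
  simp [avail]

theorem mem_step {σ : BlockState} {x y : ℕ} : y ∈ (σ.step x).1 ↔ y ∈ σ.avail ∧ y ≤ x := by
  simp [step]

theorem bounded_step (σ : BlockState) (x : ℕ) : (σ.step x).Bounded := fun _ hy =>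
  (mem_step.1 hy).2.trans (le_max_right _ _)

theorem Bounded.run {σ : BlockState} (hσ : σ.Bounded) (l : List ℕ) : (σ.run l).Bounded := by
  induction l generalizing σ with
  | nil => exact hσ
  | cons x l ih => exact ih (bounded_step σ x)

theorem run_append (σ : BlockState) (l l' : List ℕ) : σ.run (l ++ l') = (σ.run l).run l' :=
  List.foldl_append

theorem valid_append {σ : BlockState} {l l' : List ℕ} :
    σ.Valid (l ++ l') ↔ σ.Valid l ∧ (σ.run l).Valid l' := by
  induction l generalizing σ with
  | nil => simp [Valid, run]
  | cons x l ih => simp [Valid, run, ih, and_assoc]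

theorem Bounded.card_avail {σ : BlockState} (hσ : σ.Bounded) : #σ.avail = #σ.1 + 1 :=
  card_insert_of_notMem fun h => by have := hσ _ h; omega

/-- The words of length `m` which may be read from `σ`. -/
def words : ℕ → BlockState → Finset (List ℕ)
  | 0, _ => {[]}
  | m + 1, σ => σ.avail.biUnion fun x => (words m (σ.step x)).image (List.cons x)

theorem mem_words {m : ℕ} {σ : BlockState} {l : List ℕ} :
    l ∈ words m σ ↔ l.length = m ∧ σ.Valid l := by
  induction m generalizing σ l with
  | zero =>
    simp only [words, mem_singleton, List.length_eq_zero_iff]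
    exact ⟨fun h => ⟨h, h ▸ trivial⟩, fun h => h.1⟩
  | succ m ih =>
    cases l with
    | nil => simp [words]
    | cons x l => simp [words, ih, Valid]; tauto

theorem sum_words_succ (m : ℕ) (σ : BlockState) (f : List ℕ → ℕ) :
    ∑ l ∈ words (m + 1) σ, f l = ∑ x ∈ σ.avail, ∑ l ∈ words m (σ.step x), f (x :: l) := by
  rw [words, sum_biUnion]
  · exact sum_congr rfl fun x _ => sum_image fun l _ l' _ h => (List.cons.inj h).2
  · intro x _ _ _ hxy
    refine disjoint_left.2 fun _ hl hl' => hxy ?_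
    obtain ⟨_, _, rfl⟩ := mem_image.1 hl
    obtain ⟨_, _, h⟩ := mem_image.1 hl'
    exact (List.cons.inj h).1.symm

theorem sum_avail {σ : BlockState} (hσ : σ.Bounded) (f : ℕ → ℕ) :
    ∑ x ∈ σ.avail, f (#(σ.step x).1) = ∑ j ∈ range (#σ.1 + 1), f (j + 1) := by
  rw [← hσ.card_avail, ← sum_rank]
  rfl

theorem card_words {σ : BlockState} (hσ : σ.Bounded) (m : ℕ) :
    #(words m σ) = extCount m #σ.1 := by
  induction m generalizing σ with
  | zero => simp [words, extCount]
  | succ m ih =>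
    rw [card_eq_sum_ones, sum_words_succ, extCount, ← sum_avail hσ]
    exact sum_congr rfl fun x _ => by rw [← ih (bounded_step σ x), card_eq_sum_ones]

end BlockState

theorem le_foldr_max {l : List ℕ} {x : ℕ} (hx : x ∈ l) : x ≤ l.foldr max 0 := by
  induction l with
  | nil => simp at hx
  | cons y l ih =>
    rcases List.mem_cons.1 hx with rfl | h
    · simp
    · simp [ih h]

theorem foldr_max_mem {l : List ℕ} (hl : l ≠ []) : l.foldr max 0 ∈ l := by
  induction l with
  | nil => exact absurd rfl hl
  | cons y l ih =>
    rcases eq_or_ne l [] with rfl | h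
    · simp
    · rcases max_choice y (l.foldr max 0) with h' | h' <;> simp [h', ih h]

theorem foldr_max_concat (l : List ℕ) (x : ℕ) :
    (l ++ [x]).foldr max 0 = max (l.foldr max 0) x := by
  induction l with
  | nil => simp
  | cons y l ih => rw [List.cons_append, List.foldr_cons, ih, List.foldr_cons, max_assoc]

theorem getD_concat_of_lt {l : List ℕ} {i : ℕ} (x d : ℕ) (h : i < l.length) :
    (l ++ [x]).getD i d = l.getD i d := List.getD_append _ _ _ _ h

theorem getD_concat_length (l : List ℕ) (x d : ℕ) : (l ++ [x]).getD l.length d = x := by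
  simp

theorem isRGS_concat {l : List ℕ} {x : ℕ} :
    IsRGS (l ++ [x]) ↔ IsRGS l ∧ 1 ≤ x ∧ x ≤ l.foldr max 0 + 1 := by
  rcases eq_or_ne l [] with rfl | hl
  · simp [IsRGS]; omega
  have hpos : 0 < l.length := List.length_pos_iff.2 hl
  have htake : ∀ i, i + 1 < l.length → (l ++ [x]).take (i + 1) = l.take (i + 1) := fun i hi =>
    List.take_append_of_le_length hi.le
  constructor
  · rintro ⟨h0, h1, h2⟩
    refine ⟨⟨?_, fun y hy => h1 y (by simp [hy]), fun i hi => ?_⟩, h1 x (by simp), ?_⟩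
    · rwa [getD_concat_of_lt _ _ hpos] at h0
    · have := h2 i (by simp; omega)
      rwa [getD_concat_of_lt _ _ hi, htake i hi] at this
    · have := h2 (l.length - 1) (by simp; omega)
      rwa [Nat.sub_add_cancel hpos, getD_concat_length, List.take_left] at this
  · rintro ⟨⟨h0, h1, h2⟩, h3, h4⟩
    refine ⟨by rwa [getD_concat_of_lt _ _ hpos], fun y hy => ?_, fun i hi => ?_⟩
    · rcases List.mem_append.1 hy with h | h
      · exact h1 y h
      · rw [List.mem_singleton.1 h]; exact h3
    · rcases Nat.lt_or_ge (i + 1) l.length with h | h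
      · rw [getD_concat_of_lt _ _ h, htake i h]; exact h2 i h
      · have : i + 1 = l.length := by simp at hi; omega
        rw [this, getD_concat_length, List.take_left]; exact h4

theorem crossing_concat {l : List ℕ} {x : ℕ} :
    Crossing (l ++ [x]) ↔ Crossing l ∨ ∃ i j k : ℕ, i < j ∧ j < k ∧ k < l.length ∧
      l.getD i 0 = l.getD k 0 ∧ l.getD j 0 = x ∧ l.getD i 0 < x := by
  constructor
  · rintro ⟨i, j, k, m, hij, hjk, hkm, hm, h1, h2, h3⟩
    have hm' : m < l.length + 1 := by simpa using hm
    rw [getD_concat_of_lt _ _ (by omega), getD_concat_of_lt _ _ (by omega)] at h1 h3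
    rw [getD_concat_of_lt _ _ (by omega)] at h2
    rcases Nat.lt_or_ge m l.length with h | h
    · rw [getD_concat_of_lt _ _ h] at h2
      exact .inl ⟨i, j, k, m, hij, hjk, hkm, h, h1, h2, h3⟩
    · obtain rfl : m = l.length := by omega
      rw [getD_concat_length] at h2
      exact .inr ⟨i, j, k, hij, hjk, hkm, h1, h2, h2 ▸ h3⟩
  · rintro (⟨i, j, k, m, hij, hjk, hkm, hm, h1, h2, h3⟩ | ⟨i, j, k, hij, hjk, hk, h1, h2, h3⟩)
    · refine ⟨i, j, k, m, hij, hjk, hkm, by simp; omega, ?_⟩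
      rw [getD_concat_of_lt _ _ (by omega), getD_concat_of_lt _ _ (by omega),
        getD_concat_of_lt _ _ (by omega), getD_concat_of_lt _ _ hm]
      exact ⟨h1, h2, h3⟩
    · refine ⟨i, j, k, l.length, hij, hjk, hk, by simp, ?_⟩
      rw [getD_concat_of_lt _ _ (by omega), getD_concat_of_lt _ _ (by omega),
        getD_concat_of_lt _ _ (by omega), getD_concat_length]
      exact ⟨h1, h2, h2 ▸ h3⟩

theorem exists_getD_of_mem {l : List ℕ} {x : ℕ} (h : x ∈ l) :
    ∃ i < l.length, l.getD i 0 = x := by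
  obtain ⟨i, hi, rfl⟩ := List.mem_iff_getElem.1 h
  exact ⟨i, hi, List.getD_eq_getElem _ _ hi⟩

theorem getD_mem_of_lt {l : List ℕ} {i : ℕ} (h : i < l.length) : l.getD i 0 ∈ l := by
  rw [List.getD_eq_getElem _ _ h]; exact List.getElem_mem h

/-- In a restricted growth sequence all smaller letters occur before a given letter. -/
theorem IsRGS.exists_lt {l : List ℕ} (hl : IsRGS l) {j y : ℕ} (hj : j < l.length) (hy : 1 ≤ y)
    (hyj : y < l.getD j 0) : ∃ i < j, l.getD i 0 = y := by
  induction l using List.reverseRecOn generalizing j y with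
  | nil => simp at hj
  | append_singleton l x ih =>
    obtain ⟨h1, h2, h3⟩ := isRGS_concat.1 hl
    rcases Nat.lt_or_ge j l.length with h | h
    · rw [getD_concat_of_lt _ _ h] at hyj
      obtain ⟨i, hi, rfl⟩ := ih h1 h hy hyj
      exact ⟨i, hi, getD_concat_of_lt _ _ (hi.trans h)⟩
    · obtain rfl : j = l.length := by simp at hj; omega
      rw [getD_concat_length] at hyj
      suffices h : ∃ i < l.length, l.getD i 0 = y by
        obtain ⟨i, hi, rfl⟩ := h
        exact ⟨i, hi, getD_concat_of_lt _ _ hi⟩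
      have hne : l ≠ [] := by rintro rfl; simp at h3; omega
      obtain ⟨k, hk, hk'⟩ := exists_getD_of_mem (foldr_max_mem hne)
      rcases eq_or_ne (l.getD k 0) y with h | h
      · exact ⟨k, hk, h⟩
      · obtain ⟨i, hi, hi'⟩ := ih h1 hk hy (by omega)
        exact ⟨i, hi.trans hk, hi'⟩

theorem IsRGS.mem_of_le_max {l : List ℕ} (hl : IsRGS l) {y : ℕ} (hy : 1 ≤ y)
    (hy' : y ≤ l.foldr max 0) : y ∈ l := by
  have hne : l ≠ [] := by rintro rfl; simp at hy'; omega
  obtain ⟨k, hk, hk'⟩ := exists_getD_of_mem (foldr_max_mem hne)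
  rcases hy'.eq_or_lt with rfl | h
  · exact foldr_max_mem hne
  · obtain ⟨i, hi, rfl⟩ := hl.exists_lt hk hy (hk' ▸ h)
    exact getD_mem_of_lt (hi.trans hk)

/-- The letter `x` occurs in `l` and is followed by no smaller letter. -/
def OpenLetter (l : List ℕ) (x : ℕ) : Prop :=
  x ∈ l ∧ ∀ j k, j < k → k < l.length → l.getD j 0 = x → x ≤ l.getD k 0

theorem nonCrossing_concat {l : List ℕ} (hl : IsRGS l) (hc : ¬ Crossing l) {x : ℕ} :
    (IsRGS (l ++ [x]) ∧ ¬ Crossing (l ++ [x])) ↔ x = l.foldr max 0 + 1 ∨ OpenLetter l x := by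
  rw [isRGS_concat, crossing_concat]
  constructor
  · rintro ⟨⟨-, h1, h2⟩, h3⟩
    rcases h2.eq_or_lt with h | h
    · exact .inl h
    refine .inr ⟨hl.mem_of_le_max h1 (by omega), fun j k hjk hk hj => ?_⟩
    by_contra! hlt
    have hk1 := hl.2.1 _ (getD_mem_of_lt hk)
    obtain ⟨i, hi, hi'⟩ := hl.exists_lt (hjk.trans hk) hk1 (hj ▸ hlt)
    exact h3 (.inr ⟨i, j, k, hi, hjk, hk, hi', hj, hi' ▸ hlt⟩)
  · rintro (rfl | ⟨h1, h2⟩)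
    · refine ⟨⟨hl, by omega, le_rfl⟩, ?_⟩
      rintro (h | ⟨i, j, k, hij, hjk, hk, -, h, -⟩)
      · exact hc h
      · have := le_foldr_max (getD_mem_of_lt (hjk.trans hk))
        omega
    · refine ⟨⟨hl, hl.2.1 x h1, (le_foldr_max h1).trans (Nat.le_succ _)⟩, ?_⟩
      rintro (h | ⟨i, j, k, hij, hjk, hk, h, h', h''⟩)
      · exact hc h
      · have := h2 j k hjk hk h'
        omega

theorem openLetter_concat {l : List ℕ} {x y : ℕ} (hx : x = l.foldr max 0 + 1 ∨ OpenLetter l x) :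
    OpenLetter (l ++ [x]) y ↔ (y = l.foldr max 0 + 1 ∨ OpenLetter l y) ∧ y ≤ x := by
  constructor
  · rintro ⟨h1, h2⟩
    rcases eq_or_ne y x with rfl | hne
    · exact ⟨hx, le_rfl⟩
    have hy : y ∈ l := by simpa [hne] using h1
    obtain ⟨i, hi, hi'⟩ := exists_getD_of_mem hy
    refine ⟨.inr ⟨hy, fun j k hjk hk hj => ?_⟩, ?_⟩
    · have := h2 j k hjk (by simp; omega) (by rwa [getD_concat_of_lt _ _ (hjk.trans hk)])
      rwa [getD_concat_of_lt _ _ hk] at this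
    · have := h2 i l.length hi (by simp) (by rwa [getD_concat_of_lt _ _ hi])
      rwa [getD_concat_length] at this
  · rintro ⟨h1, h2⟩
    have hopen : ∀ j k, j < k → k < l.length → l.getD j 0 = y → y ≤ l.getD k 0 := by
      rcases h1 with rfl | h
      · intro j k hjk hk hj
        have := le_foldr_max (getD_mem_of_lt (hjk.trans hk))
        omega
      · exact h.2
    refine ⟨?_, fun j k hjk hk hj => ?_⟩
    · rcases h1 with rfl | h
      · rcases hx with rfl | hx
        · simp
        · have := le_foldr_max hx.1
          omega
      · simp [h.1]
    · have hk' : k < l.length + 1 := by simpa using hk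
      rw [getD_concat_of_lt _ _ (by omega)] at hj
      rcases Nat.lt_or_ge k l.length with h | h
      · rw [getD_concat_of_lt _ _ h]; exact hopen j k hjk h hj
      · obtain rfl : k = l.length := by omega
        rwa [getD_concat_length]

namespace BlockState

theorem run_of_nonCrossing (l : List ℕ) :
    ((IsRGS l ∧ ¬ Crossing l) ↔ Valid (∅, 0) l) ∧
      (Valid (∅, 0) l → (∀ x, x ∈ (run (∅, 0) l).1 ↔ OpenLetter l x) ∧
        (run (∅, 0) l).2 = l.foldr max 0) := by
  induction l using List.reverseRecOn with
  | nil => simp [IsRGS, Crossing, Valid, run, OpenLetter]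
  | append_singleton l x ih =>
    obtain ⟨ih1, ih2⟩ := ih
    have havail : Valid (∅, 0) l → ∀ y, y ∈ (run (∅, 0) l).avail ↔
        y = l.foldr max 0 + 1 ∨ OpenLetter l y := fun hv y => by
      rw [mem_avail, (ih2 hv).1, (ih2 hv).2]
    have hv : Valid (∅, 0) (l ++ [x]) ↔
        Valid (∅, 0) l ∧ x ∈ (run (∅, 0) l).avail := by
      simp [valid_append, Valid]
    constructor
    · rw [hv]
      constructor
      · intro h
        have hl : IsRGS l ∧ ¬ Crossing l :=
          ⟨(isRGS_concat.1 h.1).1, fun hc => h.2 (crossing_concat.2 (.inl hc))⟩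
        exact ⟨ih1.1 hl, (havail (ih1.1 hl) x).2 ((nonCrossing_concat hl.1 hl.2).1 h)⟩
      · rintro ⟨h1, h2⟩
        have hl := ih1.2 h1
        exact (nonCrossing_concat hl.1 hl.2).2 ((havail h1 x).1 h2)
    · rw [hv]
      rintro ⟨h1, h2⟩
      have hrun : run (∅, 0) (l ++ [x]) = (run (∅, 0) l).step x := by
        rw [run_append]; rfl
      rw [hrun]
      refine ⟨fun y => ?_, ?_⟩
      · rw [mem_step, openLetter_concat ((havail h1 x).1 h2), havail h1]
      · rw [foldr_max_concat, ← (ih2 h1).2]; rfl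

theorem ncseq_iff_mem_words {n : ℕ} {l : List ℕ} : NCseq n l ↔ l ∈ words n (∅, 0) := by
  rw [mem_words, NCseq, (run_of_nonCrossing l).1]

end BlockState

theorem ordIso_iff {s t : List ℕ} : OrdIso s t ↔ s.length = t.length ∧
    ∀ u ∈ s.zip t, ∀ w ∈ s.zip t, (u.1 < w.1 ↔ u.2 < w.2) := by
  refine and_congr_right fun hlen => ?_
  constructor
  · intro h u hu w hw
    obtain ⟨j, hj, rfl⟩ := List.mem_iff_getElem.1 hu
    obtain ⟨k, hk, rfl⟩ := List.mem_iff_getElem.1 hw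
    rw [List.length_zip, ← hlen, min_self] at hj hk
    have := h j k hj hk
    rw [List.getD_eq_getElem _ _ hj, List.getD_eq_getElem _ _ hk,
      List.getD_eq_getElem _ _ (hlen ▸ hj), List.getD_eq_getElem _ _ (hlen ▸ hk)] at this
    simpa using this
  · intro h j k hj hk
    have hmem : ∀ i, i < s.length → (s.getD i 0, t.getD i 0) ∈ s.zip t := fun i hi => by
      rw [List.getD_eq_getElem _ _ hi, List.getD_eq_getElem _ _ (hlen ▸ hi)]
      refine List.mem_iff_getElem.2 ⟨i, by simp; omega, by simp⟩
    exact h _ (hmem j hj) _ (hmem k hk)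

theorem ordIso_map {s : List ℕ} {f : ℕ → ℕ} (hf : StrictMonoOn f {x | x ∈ s}) :
    OrdIso s (s.map f) := by
  refine ordIso_iff.2 ⟨by simp, fun u hu w hw => ?_⟩
  have hzip : s.zip (s.map f) = s.map fun x => (x, f x) := by
    simpa using List.zip_map' (f := id) (g := f) (l := s)
  rw [hzip, List.mem_map] at hu hw
  obtain ⟨x, hx, rfl⟩ := hu
  obtain ⟨y, hy, rfl⟩ := hw
  exact (hf.lt_iff_lt hx hy).symm

/-- The letters replacing `1, 2, 3, …` in a copy of a word whose `1` becomes `v`, while its other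
letters become new letters above `N`. -/
def inflate (N v x : ℕ) : ℕ := if x = 1 then v else N + x - 1

theorem inflate_one (N v : ℕ) : inflate N v 1 = v := if_pos rfl

theorem inflate_of_two_le {N v x : ℕ} (hx : 2 ≤ x) : inflate N v x = N + x - 1 :=
  if_neg (by omega)

theorem inflate_lt_inflate {N v : ℕ} (hv : v ≤ N) {x y : ℕ} (hx : 1 ≤ x) (hy : 1 ≤ y) :
    inflate N v x < inflate N v y ↔ x < y := by
  unfold inflate
  split_ifs <;> omega

theorem inflate_le_inflate {N v : ℕ} (hv : v ≤ N) {x y : ℕ} (hx : 1 ≤ x) (hy : 1 ≤ y) :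
    inflate N v x ≤ inflate N v y ↔ x ≤ y := by
  rw [← not_lt, inflate_lt_inflate hv hy hx, not_lt]

theorem le_inflate {N v : ℕ} (hv : v ≤ N) {x : ℕ} (hx : 1 ≤ x) : v ≤ inflate N v x := by
  unfold inflate
  split_ifs <;> omega

/-- The copy of `(ρ + 1) 1 ^ b` whose letters `2` and `1` become `v` and `e`. -/
def copyWord (ρ : List ℕ) (b N v e : ℕ) : List ℕ :=
  ρ.map (inflate (max N v) v) ++ List.replicate b e

theorem ordIso_copyWord {ρ : List ℕ} (hρ : ∀ x ∈ ρ, 1 ≤ x) (b N : ℕ) {v e : ℕ} (hev : e < v) :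
    OrdIso (ρ.map (· + 1) ++ List.replicate b 1) (copyWord ρ b N v e) := by
  set f : ℕ → ℕ := fun x => if x = 1 then e else inflate (max N v) v (x - 1) with hf
  have hmap : (ρ.map (· + 1) ++ List.replicate b 1).map f = copyWord ρ b N v e := by
    rw [copyWord, List.map_append, List.map_map, List.map_replicate]
    congr 1
    refine List.map_congr_left fun x hx => ?_
    have := hρ x hx
    simp [hf]; omega
  rw [← hmap]
  refine ordIso_map fun x hx y hy hxy => ?_
  have hx1 : 1 ≤ x := by
    simp at hx; omega
  have hv : v ≤ max N v := le_max_right _ _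
  simp only [hf]
  rw [if_neg (show y ≠ 1 by omega)]
  split_ifs with h
  · exact hev.trans_le (le_inflate hv (by omega))
  · exact (inflate_lt_inflate hv (by omega) (by omega)).2 (by omega)

namespace BlockState

/-- The state `β` arises from `α` by inflating its letters above the set `B` of letters
smaller than `v`. -/
structure Inflates (B : Finset ℕ) (N v : ℕ) (α β : BlockState) : Prop where
  one_le : ∀ x ∈ α.1, 1 ≤ x ∧ x ≤ α.2
  pos : 1 ≤ α.2
  max_add_one : β.2 + 1 = N + α.2
  mem_iff : ∀ y, y ∈ β.1 ↔ y ∈ B ∨ ∃ x ∈ α.1, inflate N v x = y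

section Inflates

variable {B : Finset ℕ} {N v : ℕ} {α β : BlockState}

theorem Inflates.one_le_of_mem_avail (h : Inflates B N v α β) {x : ℕ} (hx : x ∈ α.avail) :
    1 ≤ x ∧ x ≤ α.2 + 1 := by
  rcases mem_avail.1 hx with rfl | hx
  · omega
  · have := h.one_le x hx
    omega

theorem Inflates.mem_avail_iff (h : Inflates B N v α β) (y : ℕ) :
    y ∈ β.avail ↔ y ∈ B ∨ ∃ x ∈ α.avail, inflate N v x = y := by
  have hnew : inflate N v (α.2 + 1) = β.2 + 1 := by
    have := h.pos
    rw [inflate_of_two_le (by omega), h.max_add_one]; omega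
  simp only [mem_avail, h.mem_iff, or_and_right, exists_or, exists_eq_left, hnew]
  tauto

theorem Inflates.step (h : Inflates B N v α β) (hv : v ≤ N) (hB : ∀ y ∈ B, y < v) {x : ℕ}
    (hx : x ∈ α.avail) : Inflates B N v (α.step x) (β.step (inflate N v x)) := by
  have hx1 := h.one_le_of_mem_avail hx
  refine ⟨fun y hy => ?_, h.pos.trans (le_max_left _ _), ?_, fun y => ?_⟩
  · exact ⟨(h.one_le_of_mem_avail (mem_step.1 hy).1).1, bounded_step α x y hy⟩
  · have h1 := h.max_add_one
    have h2 := h.pos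
    simp only [BlockState.step, inflate]
    split_ifs <;> omega
  · rw [mem_step, h.mem_avail_iff]
    constructor
    · rintro ⟨hy | ⟨z, hz, rfl⟩, hle⟩
      · exact .inl hy
      · have hz1 := h.one_le_of_mem_avail hz
        exact .inr ⟨z, mem_step.2 ⟨hz, (inflate_le_inflate hv hz1.1 hx1.1).1 hle⟩, rfl⟩
    · rintro (hy | ⟨z, hz, rfl⟩)
      · exact ⟨.inl hy, (hB y hy).le.trans (le_inflate hv hx1.1)⟩
      · obtain ⟨hz, hzx⟩ := mem_step.1 hz
        have hz1 := h.one_le_of_mem_avail hz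
        exact ⟨.inr ⟨z, hz, rfl⟩, (inflate_le_inflate hv hz1.1 hx1.1).2 hzx⟩

theorem Inflates.run (h : Inflates B N v α β) (hv : v ≤ N) (hB : ∀ y ∈ B, y < v) {l : List ℕ}
    (hl : α.Valid l) : β.Valid (l.map (inflate N v)) ∧
      Inflates B N v (α.run l) (β.run (l.map (inflate N v))) := by
  induction l generalizing α β with
  | nil => exact ⟨trivial, h⟩
  | cons x l ih =>
    obtain ⟨h1, h2⟩ := ih (h.step hv hB hl.1) hl.2
    exact ⟨⟨(h.mem_avail_iff _).2 (.inr ⟨x, hl.1, rfl⟩), h1⟩, h2⟩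

/-- A word read from `β` which compares like the word `l` read from `α` is the inflation
of `l`. -/
theorem Inflates.eq_map (h : Inflates B N v α β) (hv : v ≤ N) (hB : ∀ y ∈ B, y < v)
    {l s : List ℕ} (hl : α.Valid l) (hs : β.Valid s) (hlen : l.length = s.length)
    (hold : ∀ z, 1 ≤ z → z ≤ α.2 → ∀ w ∈ l.zip s,
      (z < w.1 ↔ inflate N v z < w.2) ∧ (w.1 < z ↔ w.2 < inflate N v z))
    (hnew : ∀ u ∈ l.zip s, ∀ w ∈ l.zip s, (u.1 < w.1 ↔ u.2 < w.2)) :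
    s = l.map (inflate N v) := by
  induction l generalizing α β s with
  | nil => simpa using hlen.symm
  | cons x l ih =>
    cases s with
    | nil => simp at hlen
    | cons y s =>
      obtain ⟨hx, hl⟩ := hl
      obtain ⟨hy, hs⟩ := hs
      have hx1 := h.one_le_of_mem_avail hx
      have hpos := h.pos
      have hcmp := fun z h1 h2 => hold z h1 h2 (x, y) (by simp)
      have hyx : y = inflate N v x := by
        rcases hx1.2.lt_or_eq with hlt | heq
        · have := hcmp x hx1.1 (by omega)
          omega
        · have hgt := ((hcmp α.2 hpos le_rfl).1).1 (by simp only; omega)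
          simp only at hgt
          rcases (h.mem_avail_iff y).1 hy with hyB | ⟨z, hz, rfl⟩
          · have h1 := hB y hyB
            have h2 := le_inflate hv hpos
            omega
          · have hz1 := h.one_le_of_mem_avail hz
            rw [inflate_lt_inflate hv hpos hz1.1] at hgt
            rw [show z = x by omega]
      subst hyx
      rw [List.map_cons, ih (h.step hv hB hx) hl hs (by simpa using hlen) ?_
        fun u hu w hw => hnew u (by simp [hu]) w (by simp [hw])]
      intro z hz1 hz2 w hw
      rcases Nat.lt_or_ge α.2 z with hlt | hle
      · have hzx : z = x := by simp only [BlockState.step] at hz2; omega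
        subst hzx
        exact ⟨hnew (z, inflate N v z) (by simp) w (by simp [hw]),
          hnew w (by simp [hw]) (z, inflate N v z) (by simp)⟩
      · exact hold z hz1 hle w (by simp [hw])

end Inflates

theorem inflates_step_one (σ : BlockState) {v : ℕ} (hv : v ∈ σ.avail) :
    Inflates {y ∈ σ.avail | y < v} (max σ.2 v) v (step (∅, 0) 1) (σ.step v) := by
  refine ⟨fun x hx => ?_, by simp [step], by simp [step], fun y => ?_⟩
  · have := mem_step.1 hx
    simp [avail] at this
    simp [step, this]
  · have hone : (step (∅, 0) 1).1 = {1} := rfl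
    simp only [mem_step, hone, mem_filter, mem_singleton, exists_eq_left, inflate_one,
      le_iff_lt_or_eq]
    constructor
    · rintro ⟨h, h' | rfl⟩
      · exact .inl ⟨h, h'⟩
      · exact .inr rfl
    · rintro (⟨h, h'⟩ | rfl)
      · exact ⟨h, .inl h'⟩
      · exact ⟨hv, .inr rfl⟩

theorem valid_replicate {σ : BlockState} {e b : ℕ} (hb : 1 ≤ b) (he : e ∈ σ.avail) :
    σ.Valid (List.replicate b e) ∧
      (σ.run (List.replicate b e)).1 = {y ∈ σ.avail | y ≤ e} := by
  induction b, hb using Nat.le_induction generalizing σ with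
  | base => simp [Valid, run, he, step]
  | succ b hb ih =>
    have he' : e ∈ (σ.step e).avail := mem_avail.2 (.inr (mem_step.2 ⟨he, le_rfl⟩))
    obtain ⟨h1, h2⟩ := ih he'
    refine ⟨⟨he, h1⟩, h2.trans ?_⟩
    ext y
    simp only [mem_filter, mem_avail (σ := σ.step e), mem_step]
    constructor
    · rintro ⟨rfl | h, hle⟩
      · simp only [step] at hle; omega
      · exact h
    · exact fun h => ⟨.inr h, h.2⟩

theorem valid_eq_one_cons {ρ : List ℕ} (hρ : Valid (∅, 0) ρ) (hne : ρ ≠ []) :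
    ∃ ρ', ρ = 1 :: ρ' ∧ (step (∅, 0) 1).Valid ρ' := by
  cases ρ with
  | nil => exact absurd rfl hne
  | cons x ρ' =>
    obtain ⟨h1, h2⟩ := hρ
    obtain rfl : x = 1 := by simpa [avail] using h1
    exact ⟨ρ', rfl, h2⟩

theorem valid_copyWord {σ : BlockState} {ρ : List ℕ} (hρ : Valid (∅, 0) ρ) (hne : ρ ≠ [])
    {b v e : ℕ} (hb : 1 ≤ b) (hv : v ∈ σ.avail) (he : e ∈ σ.avail) (hev : e < v) :
    σ.Valid (copyWord ρ b σ.2 v e) ∧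
      (σ.run (copyWord ρ b σ.2 v e)).1 = (σ.step e).1 := by
  obtain ⟨ρ', rfl, hρ'⟩ := valid_eq_one_cons hρ hne
  have hB : ∀ y ∈ {y ∈ σ.avail | y < v}, y < v := fun y hy => (mem_filter.1 hy).2
  have hvN := le_max_right σ.2 v
  obtain ⟨h1, h2⟩ := (inflates_step_one σ hv).run hvN hB hρ'
  rw [copyWord, List.map_cons, inflate_one, List.cons_append, ← List.singleton_append,
    valid_append, valid_append, run_append, run_append]
  have heB : e ∈ {y ∈ σ.avail | y < v} := mem_filter.2 ⟨he, hev⟩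
  obtain ⟨h3, h4⟩ := valid_replicate hb ((h2.mem_avail_iff e).2 (.inl heB))
  refine ⟨⟨⟨hv, trivial⟩, h1, h3⟩, h4.trans ?_⟩
  ext y
  rw [mem_filter, h2.mem_avail_iff, mem_step]
  constructor
  · rintro ⟨hy | ⟨x, hx, rfl⟩, hle⟩
    · exact ⟨(mem_filter.1 hy).1, hle⟩
    · have := le_inflate hvN (h2.one_le_of_mem_avail hx).1
      omega
  · rintro ⟨hy, hle⟩
    exact ⟨.inl (mem_filter.2 ⟨hy, hle.trans_lt hev⟩), hle⟩

/-- A word read from `σ` which is order-isomorphic to `(ρ + 1) 1 ^ b` is one of its copies. -/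
theorem eq_copyWord {σ : BlockState} {ρ : List ℕ} (hρ : Valid (∅, 0) ρ) (hne : ρ ≠ [])
    {b : ℕ} (hb : 1 ≤ b) {s : List ℕ} (hs : σ.Valid s)
    (hiso : OrdIso (ρ.map (· + 1) ++ List.replicate b 1) s) :
    ∃ v ∈ σ.avail, ∃ e ∈ σ.avail, e < v ∧ s = copyWord ρ b σ.2 v e := by
  obtain ⟨ρ', rfl, hρ'⟩ := valid_eq_one_cons hρ hne
  obtain ⟨hlen, hcmp⟩ := ordIso_iff.1 hiso
  obtain ⟨s₁, s₂, rfl, hs₁⟩ : ∃ s₁ s₂, s = s₁ ++ s₂ ∧ s₁.length = ρ'.length + 1 :=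
    ⟨s.take (ρ'.length + 1), s.drop (ρ'.length + 1), (List.take_append_drop _ _).symm, by
      simp at hlen ⊢; omega⟩
  have hs₂ : s₂.length = b := by simp at hlen; omega
  obtain ⟨v, t, rfl⟩ := List.exists_cons_of_length_pos (l := s₁) (by omega)
  obtain ⟨e, t₂, rfl⟩ := List.exists_cons_of_length_pos (l := s₂) (by omega)
  rw [List.zip_append (by simp [hs₁])] at hcmp
  obtain ⟨⟨hv, ht⟩, hs₂'⟩ := valid_append.1 hs
  have hB : ∀ y ∈ {y ∈ σ.avail | y < v}, y < v := fun y hy => (mem_filter.1 hy).2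
  have hvN := le_max_right σ.2 v
  have hinf := inflates_step_one σ hv
  have hmem₁ : ∀ w ∈ ρ'.zip t, (w.1 + 1, w.2) ∈
      ((1 :: ρ').map (· + 1)).zip (v :: t) ++ (List.replicate b 1).zip (e :: t₂) := by
    intro w hw
    simp only [List.map_cons, List.zip_cons_cons, List.zip_map_left, List.mem_append,
      List.mem_cons, List.mem_map]
    exact .inl (.inr ⟨w, hw, rfl⟩)
  have hmemv : (2, v) ∈
      ((1 :: ρ').map (· + 1)).zip (v :: t) ++ (List.replicate b 1).zip (e :: t₂) := by simp
  have hmem₂ : ∀ y ∈ e :: t₂, (1, y) ∈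
      ((1 :: ρ').map (· + 1)).zip (v :: t) ++ (List.replicate b 1).zip (e :: t₂) := by
    intro y hy
    refine List.mem_append_right _ ?_
    obtain ⟨i, hi, rfl⟩ := List.mem_iff_getElem.1 hy
    exact List.mem_iff_getElem.2 ⟨i, by simpa [← hs₂] using hi, by simp⟩
  have hev : e < v := (hcmp _ (hmem₂ e (by simp)) _ hmemv).1 (by simp)
  have hrep : e :: t₂ = List.replicate b e := List.eq_replicate_iff.2 ⟨hs₂, fun y hy => by
    have h1 := hcmp _ (hmem₂ e (by simp)) _ (hmem₂ y hy)
    have h2 := hcmp _ (hmem₂ y hy) _ (hmem₂ e (by simp))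
    simp at h1 h2
    omega⟩
  have hmap : t = ρ'.map (inflate (max σ.2 v) v) := by
    refine hinf.eq_map hvN hB hρ' ht (by simpa using hs₁.symm) (fun z h1 h2 w hw => ?_)
      fun u hu w hw => ?_
    · obtain rfl : z = 1 := by simp [step] at h2; omega
      have h3 := hcmp _ hmemv _ (hmem₁ w hw)
      have h4 := hcmp _ (hmem₁ w hw) _ hmemv
      rw [inflate_one, ← h3, ← h4]
      simp only
      omega
    · rw [← hcmp _ (hmem₁ u hu) _ (hmem₁ w hw)]
      simp
  have hfin := (hinf.run hvN hB hρ').2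
  refine ⟨v, hv, e, ?_, hev, ?_⟩
  · have he : e ∈ ((σ.step v).run t).avail := hs₂'.1
    rw [hmap, hfin.mem_avail_iff] at he
    rcases he with he | ⟨x, hx, rfl⟩
    · exact (mem_filter.1 he).1
    · have := le_inflate hvN (hfin.one_le_of_mem_avail hx).1
      omega
  · rw [hrep, copyWord, List.map_cons, inflate_one, ← hmap]

end BlockState

namespace BlockState

theorem length_copyWord (ρ : List ℕ) (b N v e : ℕ) :
    (copyWord ρ b N v e).length = ρ.length + b := by simp [copyWord]

theorem copyWord_inj {ρ : List ℕ} (hρ : Valid (∅, 0) ρ) (hne : ρ ≠ []) {b N v e v' e' : ℕ}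
    (hb : 1 ≤ b) (h : copyWord ρ b N v e = copyWord ρ b N v' e') : v = v' ∧ e = e' := by
  obtain ⟨ρ', rfl, -⟩ := valid_eq_one_cons hρ hne
  obtain ⟨h1, h2⟩ := List.append_inj h (by simp)
  refine ⟨?_, ?_⟩
  · simpa [inflate_one] using (List.cons.inj h1).1
  · obtain ⟨c, rfl⟩ := Nat.exists_eq_add_of_le' hb
    exact (List.cons.inj h2).1

open Classical in
theorem card_filter_occAt_zero {σ : BlockState} (hσ : σ.Bounded) {ρ : List ℕ}
    (hρ : Valid (∅, 0) ρ) (hne : ρ ≠ []) {b : ℕ} (hb : 1 ≤ b) (hpos : ∀ x ∈ ρ, 1 ≤ x) (m : ℕ) :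
    #{l ∈ words (m + (ρ.length + b)) σ | occAt (ρ.map (· + 1) ++ List.replicate b 1) l 0} =
      ∑ i ∈ range (#σ.1 + 1), dropCount m i := by
  have hset : {l ∈ words (m + (ρ.length + b)) σ |
        occAt (ρ.map (· + 1) ++ List.replicate b 1) l 0} =
      (σ.avail.sigma fun v => {e ∈ σ.avail | e < v}).biUnion fun p =>
        (words m (σ.run (copyWord ρ b σ.2 p.1 p.2))).image (copyWord ρ b σ.2 p.1 p.2 ++ ·) := by
    ext l
    simp only [mem_filter, mem_words, mem_biUnion, mem_sigma, mem_image, occAt, List.drop_zero,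
      List.length_append, List.length_map, List.length_replicate]
    constructor
    · rintro ⟨⟨hlen, hval⟩, hiso⟩
      rw [← List.take_append_drop (ρ.length + b) l] at hval
      obtain ⟨h1, h2⟩ := valid_append.1 hval
      obtain ⟨v, hv, e, he, hev, heq⟩ := eq_copyWord hρ hne hb h1 hiso
      refine ⟨⟨v, e⟩, ⟨hv, he, hev⟩, l.drop (ρ.length + b), ⟨by simp; omega, ?_⟩, ?_⟩
      · rwa [← heq]
      · rw [← heq, List.take_append_drop]
    · rintro ⟨⟨v, e⟩, ⟨hv, he, hev⟩, q, ⟨hq, hval⟩, rfl⟩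
      refine ⟨⟨by simp [length_copyWord, hq, add_comm], valid_append.2
        ⟨(valid_copyWord hρ hne hb hv he hev).1, hval⟩⟩, ?_⟩
      rw [List.take_left' (length_copyWord ..)]
      exact ordIso_copyWord hpos b σ.2 hev
  rw [hset, card_biUnion]
  · have hdrop : ∀ v ∈ σ.avail, ∑ e ∈ σ.avail with e < v,
        #((words m (σ.run (copyWord ρ b σ.2 v e))).image (copyWord ρ b σ.2 v e ++ ·)) =
          dropCount m (#(σ.step v).1 - 1) := by
      intro v hv
      have hcard : #(σ.step v).1 - 1 = #{e ∈ σ.avail | e < v} := by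
        have : (σ.step v).1 = insert v {e ∈ σ.avail | e < v} := by
          ext y
          rw [mem_step, mem_insert, mem_filter, le_iff_lt_or_eq]
          constructor
          · tauto
          · rintro (rfl | h)
            exacts [⟨hv, .inr rfl⟩, ⟨h.1, .inl h.2⟩]
        rw [this, card_insert_of_notMem (by simp), Nat.add_sub_cancel]
      rw [hcard, dropCount, ← sum_rank]
      refine sum_congr rfl fun e he => ?_
      obtain ⟨he, hev⟩ := mem_filter.1 he
      rw [card_image_of_injective _ (List.append_right_injective _), card_words (hσ.run _),
        (valid_copyWord hρ hne hb hv he hev).2]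
      congr 2
      ext y
      simp only [mem_step, mem_filter]
      constructor
      · exact fun h => ⟨⟨h.1, h.2.trans_lt hev⟩, h.2⟩
      · exact fun h => ⟨h.1.1, h.2⟩
    rw [sum_sigma, sum_congr rfl hdrop, sum_avail hσ fun k => dropCount m (k - 1)]
    simp
  · rintro ⟨v, e⟩ - ⟨v', e'⟩ - hne'
    refine disjoint_left.2 fun l hl hl' => hne' ?_
    obtain ⟨q, -, rfl⟩ := mem_image.1 hl
    obtain ⟨q', -, h⟩ := mem_image.1 hl'
    obtain ⟨rfl, rfl⟩ := copyWord_inj hρ hne hb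
      (List.append_inj h (by rw [length_copyWord, length_copyWord])).1
    rfl

open Classical in
/-- The total number of occurrences of `τ` in the words of length `m` read from `σ`. -/
noncomputable def occTotal (τ : List ℕ) (m : ℕ) (σ : BlockState) : ℕ :=
  ∑ l ∈ words m σ, ∑ i ∈ range m, if occAt τ l i then 1 else 0

theorem occAt_length_le {τ l : List ℕ} {i : ℕ} (h : occAt τ l i) : τ.length + i ≤ l.length ∨
    τ = [] := by
  have := h.1
  rcases eq_or_ne τ [] with h' | h'
  · exact .inr h'
  · have := List.length_pos_iff.2 h'
    simp at *; omega

open Classical in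
theorem occTotal_succ (τ : List ℕ) (m : ℕ) (σ : BlockState) :
    occTotal τ (m + 1) σ =
      ∑ x ∈ σ.avail, occTotal τ m (σ.step x) + #{l ∈ words (m + 1) σ | occAt τ l 0} := by
  rw [occTotal, card_filter, sum_congr rfl fun l _ => sum_range_succ' _ m, sum_add_distrib,
    sum_words_succ]
  rfl

theorem occTotal_of_lt {τ : List ℕ} {m : ℕ} (h : m < τ.length) (σ : BlockState) :
    occTotal τ m σ = 0 := by
  refine sum_eq_zero fun l hl => sum_eq_zero fun i _ => if_neg fun ho => ?_
  have hlen := (mem_words.1 hl).1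
  rcases occAt_length_le ho with h' | rfl
  · omega
  · simp at h

/-- Total number of occurrences in terms of the number of open blocks. -/
theorem occTotal_eq {ρ : List ℕ} (hρ : Valid (∅, 0) ρ) (hne : ρ ≠ []) {b : ℕ} (hb : 1 ≤ b)
    (hpos : ∀ x ∈ ρ, 1 ≤ x) {m c : ℕ} (hc : ρ.length + b = c + 1) {σ : BlockState}
    (hσ : σ.Bounded) :
    occTotal (ρ.map (· + 1) ++ List.replicate b 1) (m + 1 + c) σ =
      ∑ i ∈ range (#σ.1 + 1), descentCount m i := by
  classical
  have hsucc (m : ℕ) {σ : BlockState} (hσ : σ.Bounded) :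
      occTotal (ρ.map (· + 1) ++ List.replicate b 1) (m + 1 + c) σ =
        ∑ x ∈ σ.avail, occTotal (ρ.map (· + 1) ++ List.replicate b 1) (m + c) (σ.step x) +
          ∑ i ∈ range (#σ.1 + 1), dropCount m i := by
    rw [add_right_comm, occTotal_succ, ← card_filter_occAt_zero hσ hρ hne hb hpos, hc, add_assoc]
  induction m generalizing σ with
  | zero =>
    rw [hsucc 0 hσ, sum_eq_zero fun x _ => occTotal_of_lt (by simp; omega) _, zero_add]
    rfl
  | succ m ih =>
    rw [hsucc (m + 1) hσ, sum_congr rfl fun x _ => ih (bounded_step σ x),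
      sum_avail hσ fun k => ∑ i ∈ range (k + 1), descentCount m i, ← sum_add_distrib]
    rfl

theorem totalOcc_eq_occTotal (n : ℕ) {τ : List ℕ} (hτ : τ ≠ []) :
    totalOcc n τ = occTotal τ n (∅, 0) := by
  classical
  have hset : {p : List ℕ × ℕ | NCseq n p.1 ∧ occAt τ p.1 p.2} =
      ↑{p ∈ words n (∅, 0) ×ˢ range n | occAt τ p.1 p.2} := by
    ext ⟨l, i⟩
    simp only [Set.mem_ofPred_eq, coe_filter, mem_product, ncseq_iff_mem_words, mem_range]
    constructor
    · rintro ⟨hl, ho⟩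
      have hlen := (mem_words.1 hl).1
      have hpos := List.length_pos_iff.2 hτ
      have := (occAt_length_le ho).resolve_right hτ
      exact ⟨⟨hl, by omega⟩, ho⟩
    · rintro ⟨⟨hl, -⟩, ho⟩
      exact ⟨hl, ho⟩
  calc totalOcc n τ = Set.ncard {p : List ℕ × ℕ | NCseq n p.1 ∧ occAt τ p.1 p.2} := rfl
    _ = occTotal τ n (∅, 0) := by
      rw [hset, Set.ncard_coe_finset, card_filter, sum_product, occTotal]

end BlockState

/-- For τ = (ρ+1)1^b with ρ a non-crossing canonical form of length a ≥ 1
(starting with a single 1 if b ≥ 2) and n ≥ a + b − 1, the total number of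
occurrences of τ over NC_n equals binom(2r−2, r+1), where r = n − a − b + 2. -/
theorem stmt10 (a b n : ℕ) (ρ : List ℕ) (ha : 1 ≤ a) (hb : 1 ≤ b)
    (hρ : NCseq a ρ) (hsingle : 2 ≤ b → 1 < a → ρ.getD 1 0 = 2)
    (hn : a + b - 1 ≤ n) :
    totalOcc n (ρ.map (· + 1) ++ List.replicate b 1) =
      Nat.choose (2 * (n + 2 - a - b) - 2) ((n + 2 - a - b) + 1) := by
  have hval : BlockState.Valid (∅, 0) ρ :=
    (BlockState.mem_words.1 (BlockState.ncseq_iff_mem_words.1 hρ)).2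
  have hlen : ρ.length = a := hρ.1
  have hne : ρ ≠ [] := List.length_pos_iff.1 (by omega)
  obtain ⟨m, rfl⟩ := Nat.exists_eq_add_of_le' hn
  rw [BlockState.totalOcc_eq_occTotal _ (by simp [hne])]
  cases m with
  | zero =>
    rw [BlockState.occTotal_of_lt (by simp; omega)]
    exact (Nat.choose_eq_zero_of_lt (by omega)).symm
  | succ m =>
    rw [BlockState.occTotal_eq hval hne hb hρ.2.1.2.1 (by omega) (by simp [BlockState.Bounded])]
    simp only [card_empty, zero_add, sum_range_one, descentCount_eq]
    rw [show m + 1 + (a + b - 1) + 2 - a - b = m + 2 by omega, zero_mul, zero_add]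
    congr 1
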